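/- arXiv:2210.06947 — 5 statements merged into one kernel-verified Lean document; each statement's English description precedes it below -/
import Mathlib

section
/- Let Q ∈ ℝ^{n×n} be symmetric positive semidefinite and let S ∈ ℝ^{n×n} be symmetric positive definite, with factorization S = L Lᵀ for an invertible L ∈ ℝ^{n×n}. Let λ₁ ≥ λ₂ ≥ … ≥ λ_n denote the eigenvalues (in descending order) of the symmetric positive semidefinite matrix A = L⁻¹ Q L⁻ᵀ. Then for every m with 1 ≤ m ≤ n and every matrix M ∈ ℝ^{m×n} with rank(M) = m, trace((M S Mᵀ)⁻¹ M Q Mᵀ) ≤ λ₁ + λ₂ + ⋯ + λ_m. (Upper-bound half of the paper's Theorem 1 on fusion-optimal dimension reduction.) -/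
open Matrix

/-- A weighted sum of a decreasing sequence, with weights in `[0, 1]` of total mass `m`, is at most
the sum of its first `m` terms. -/
theorem Antitone.sum_mul_le_sum_castLE {n m : ℕ} (hm : 1 ≤ m) (hmn : m ≤ n) {lam w : Fin n → ℝ}
    (hlam : Antitone lam) (h0 : ∀ i, 0 ≤ w i) (h1 : ∀ i, w i ≤ 1) (hw : ∑ i, w i = m) :
    ∑ i, w i * lam i ≤ ∑ i : Fin m, lam (Fin.castLE hmn i) := by
  obtain ⟨k, rfl⟩ := Nat.exists_eq_add_of_le hmn
  rw [Fin.sum_univ_add] at hw ⊢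
  set c := lam (Fin.castAdd k ⟨m - 1, by omega⟩) with hc
  have head : ∀ i : Fin m, w (Fin.castAdd k i) * lam (Fin.castAdd k i) ≤
      lam (Fin.castAdd k i) - c + w (Fin.castAdd k i) * c := fun i => by
    have : c ≤ lam (Fin.castAdd k i) := hlam (Fin.mk_le_mk.2 (by dsimp; omega))
    nlinarith [h1 (Fin.castAdd k i)]
  have tail : ∀ i : Fin k, w (Fin.natAdd m i) * lam (Fin.natAdd m i) ≤
      w (Fin.natAdd m i) * c := fun i =>
    mul_le_mul_of_nonneg_left (hlam (Fin.mk_le_mk.2 (by dsimp; omega))) (h0 _)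
  have H := add_le_add (Finset.sum_le_sum fun i (_ : i ∈ Finset.univ) => head i)
    (Finset.sum_le_sum fun i (_ : i ∈ Finset.univ) => tail i)
  refine H.trans (le_of_eq ?_)
  rw [Finset.sum_add_distrib, Finset.sum_sub_distrib, ← Finset.sum_mul, ← Finset.sum_mul, add_assoc,
    ← add_mul, hw]
  simp
  rfl

/-- The diagonal entries of an orthogonal projection matrix lie in `[0, 1]`. -/
theorem Matrix.IsSymm.diag_mem_Icc_of_isIdempotentElem {ι : Type*} [Fintype ι]
    {P : Matrix ι ι ℝ} (hP : P.IsSymm) (hPP : IsIdempotentElem P) (i : ι) :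
    P i i ∈ Set.Icc 0 1 := by
  have h : P i i = ∑ j, P i j ^ 2 := by
    conv_lhs => rw [← hPP.eq, mul_apply]
    exact Finset.sum_congr rfl fun j _ => by rw [hP.apply i j, sq]
  have h0 : 0 ≤ P i i := h ▸ Finset.sum_nonneg fun j _ => sq_nonneg _
  have h1 : P i i ^ 2 ≤ P i i := by
    conv_rhs => rw [h]
    exact Finset.single_le_sum (f := fun j => P i j ^ 2) (fun j _ => sq_nonneg _)
      (Finset.mem_univ i)
  exact ⟨h0, by nlinarith⟩

/-- A square matrix of full rank over a field has unit determinant. -/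
theorem Matrix.isUnit_det_of_rank_eq_card {ι K : Type*} [Fintype ι] [DecidableEq ι] [Field K]
    {A : Matrix ι ι K} (hA : A.rank = Fintype.card ι) : IsUnit A.det := by
  rw [← isUnit_iff_isUnit_det, ← mulVec_surjective_iff_isUnit]
  refine LinearMap.range_eq_top (f := A.mulVecLin).1 (Submodule.eq_top_of_finrank_eq ?_)
  rw [Module.finrank_fintype_fun_eq_card]
  exact hA

/-- Ky Fan's inequality: the trace of `P A`, for an orthogonal projection `P` of trace `m`, is at
most the sum of the `m` largest eigenvalues of `A`. -/
theorem Matrix.IsHermitian.trace_mul_le_sum_eigenvalues {n m : ℕ} (hm : 1 ≤ m) (hmn : m ≤ n)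
    {A P : Matrix (Fin n) (Fin n) ℝ} (hA : A.IsHermitian) {lam : Fin n → ℝ}
    (σ : Equiv.Perm (Fin n)) (hlam : ∀ i, lam i = hA.eigenvalues (σ i)) (hdesc : Antitone lam)
    (hP : P.IsSymm) (hPP : IsIdempotentElem P) (htr : P.trace = m) :
    (P * A).trace ≤ ∑ i : Fin m, lam (Fin.castLE hmn i) := by
  set U : Matrix (Fin n) (Fin n) ℝ := hA.eigenvectorUnitary.1
  have hUU : U * Uᵀ = 1 := Unitary.coe_mul_star_self hA.eigenvectorUnitary
  have hspec : A = U * diagonal hA.eigenvalues * Uᵀ := hA.spectral_theorem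
  set W := Uᵀ * P * U with hW
  have hWs : W.IsSymm := by
    simp only [Matrix.IsSymm, hW, transpose_mul, transpose_transpose, hP.eq, Matrix.mul_assoc]
  have hWW : IsIdempotentElem W := by
    calc W * W = Uᵀ * (P * (U * Uᵀ) * P) * U := by simp only [hW, Matrix.mul_assoc]
      _ = W := by rw [hUU, Matrix.mul_one, hPP.eq]
  have hWt : W.trace = m := by
    rw [hW, trace_mul_comm, ← Matrix.mul_assoc, hUU, Matrix.one_mul, htr]
  have hWd := hWs.diag_mem_Icc_of_isIdempotentElem hWW
  have htrace : (P * A).trace = ∑ i, W (σ i) (σ i) * lam i := by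
    calc (P * A).trace = (P * U * diagonal hA.eigenvalues * Uᵀ).trace := by
          conv_lhs => rw [hspec]
          simp only [Matrix.mul_assoc]
      _ = (W * diagonal hA.eigenvalues).trace := by
          rw [trace_mul_comm]; simp only [hW, Matrix.mul_assoc]
      _ = ∑ i, W i i * hA.eigenvalues i := by simp [trace, mul_diagonal]
      _ = ∑ i, W (σ i) (σ i) * lam i := by
          simp only [hlam]
          exact (Equiv.sum_comp σ fun i => W i i * hA.eigenvalues i).symm
  rw [htrace]
  refine hdesc.sum_mul_le_sum_castLE hm hmn (fun i => (hWd _).1) (fun i => (hWd _).2) ?_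
  rw [← hWt]
  exact Equiv.sum_comp σ fun i => W i i


/-- Upper-bound half of the paper's Theorem 1: for symmetric PSD `Q`, symmetric PD `S = L Lᵀ`,
and eigenvalues `lam` of `A = L⁻¹ Q L⁻ᵀ` listed in descending order, every full-row-rank
`M ∈ ℝ^{m×n}` satisfies `trace((M S Mᵀ)⁻¹ M Q Mᵀ) ≤ λ₁ + ⋯ + λ_m`. -/
theorem stmt_0 {n m : ℕ} (hm : 1 ≤ m) (hmn : m ≤ n)
    (Q S L : Matrix (Fin n) (Fin n) ℝ)
    (hQ : Q.PosSemidef) (hS : S.PosDef)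
    (hL : IsUnit L.det) (hSL : S = L * Lᵀ)
    (hA : (L⁻¹ * Q * (L⁻¹)ᵀ).IsHermitian)
    (lam : Fin n → ℝ) (σ : Equiv.Perm (Fin n))
    (hlam : ∀ i, lam i = hA.eigenvalues (σ i))
    (hdesc : ∀ i j : Fin n, i ≤ j → lam j ≤ lam i)
    (M : Matrix (Fin m) (Fin n) ℝ) (hrank : M.rank = m) :
    ((M * S * Mᵀ)⁻¹ * (M * Q * Mᵀ)).trace ≤ ∑ i : Fin m, lam (Fin.castLE hmn i) := by
  set N := M * L with hN
  have hNN : M * S * Mᵀ = N * Nᵀ := by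
    simp only [hSL, hN, transpose_mul, Matrix.mul_assoc]
  have hNA : M * Q * Mᵀ = N * (L⁻¹ * Q * (L⁻¹)ᵀ) * Nᵀ := by
    have hLT : (L⁻¹)ᵀ * Lᵀ = 1 := by rw [← transpose_mul, mul_nonsing_inv _ hL, transpose_one]
    calc M * Q * Mᵀ = M * (L * L⁻¹) * Q * ((L⁻¹)ᵀ * Lᵀ) * Mᵀ := by
          rw [hLT, mul_nonsing_inv _ hL, Matrix.mul_one, Matrix.mul_one]
      _ = _ := by simp only [hN, transpose_mul, Matrix.mul_assoc]
  have hG : IsUnit (N * Nᵀ).det := isUnit_det_of_rank_eq_card <| by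
    rw [rank_self_mul_transpose, hN, rank_mul_eq_left_of_isUnit_det _ _ hL, hrank, Fintype.card_fin]
  set P := Nᵀ * (N * Nᵀ)⁻¹ * N with hP
  have hPs : P.IsSymm := by
    simp only [Matrix.IsSymm, hP, transpose_mul, transpose_nonsing_inv, transpose_transpose,
      Matrix.mul_assoc]
  have hPP : IsIdempotentElem P := by
    calc P * P = Nᵀ * ((N * Nᵀ)⁻¹ * (N * Nᵀ)) * (N * Nᵀ)⁻¹ * N := by
          simp only [hP, Matrix.mul_assoc]
      _ = P := by rw [nonsing_inv_mul _ hG, Matrix.mul_one]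
  have hPt : P.trace = m := by
    rw [hP, trace_mul_comm, ← Matrix.mul_assoc, mul_nonsing_inv _ hG, trace_one, Fintype.card_fin]
  have htrace : ((M * S * Mᵀ)⁻¹ * (M * Q * Mᵀ)).trace = (P * (L⁻¹ * Q * (L⁻¹)ᵀ)).trace := by
    rw [hNN, hNA, ← Matrix.mul_assoc, trace_mul_comm]
    simp only [hP, Matrix.mul_assoc]
  rw [htrace]
  exact hA.trace_mul_le_sum_eigenvalues hm hmn σ hlam hdesc hPs hPP hPt
end

section
/- Let Q ∈ ℝ^{n×n} be symmetric positive semidefinite and let S ∈ ℝ^{n×n} be symmetric positive definite, with S = L Lᵀ for an invertible L. Let λ₁ ≥ … ≥ λ_n be the eigenvalues of A = L⁻¹ Q L⁻ᵀ and let w₁, …, w_m be orthonormal eigenvectors of A with A wᵢ = λᵢ wᵢ for i = 1, …, m (m ≤ n). Define uᵢ = L⁻ᵀ wᵢ and let M ∈ ℝ^{m×n} be the matrix whose i-th row is uᵢᵀ. Then: (i) each uᵢ satisfies the generalized eigenvector equation Q uᵢ = λᵢ S uᵢ; (ii) M S Mᵀ = I_m, so rank(M) = m; and (iii) trace((M S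 Mᵀ)⁻¹ M Q Mᵀ) = λ₁ + ⋯ + λ_m, i.e., M attains the maximal value of the trace objective. (Attainment half of the paper's Theorem 1.) -/
open Matrix

/-- The entries of `N * B * Nᵀ` are the values of the bilinear form of `B` on the rows of `N`. -/
theorem Matrix.mul_mul_transpose_apply_eq_dotProduct {m n R : Type*} [Fintype n] [CommSemiring R]
    (N : Matrix m n R) (B : Matrix n n R) (i j : m) :
    (N * B * Nᵀ) i j = N i ⬝ᵥ (B *ᵥ N j) := by
  rw [Matrix.mul_assoc]
  rfl

/-- Attainment half of the paper's Theorem 1: with `uᵢ = L⁻ᵀ wᵢ` for orthonormal eigenvectors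
`wᵢ` of `A = L⁻¹ Q L⁻ᵀ` associated with the `m` largest eigenvalues, the matrix `M` whose rows
are the `uᵢᵀ` satisfies `Q uᵢ = λᵢ S uᵢ`, `M S Mᵀ = I`, `rank M = m`, and attains
`trace((M S Mᵀ)⁻¹ M Q Mᵀ) = λ₁ + ⋯ + λ_m`. -/
theorem stmt_1 {n m : ℕ} (hmn : m ≤ n)
    (Q S L : Matrix (Fin n) (Fin n) ℝ)
    (hQ : Q.PosSemidef) (hS : S.PosDef)
    (hL : IsUnit L.det) (hSL : S = L * Lᵀ)
    (hA : (L⁻¹ * Q * (L⁻¹)ᵀ).IsHermitian)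
    (lam : Fin n → ℝ) (σ : Equiv.Perm (Fin n))
    (hlam : ∀ i, lam i = hA.eigenvalues (σ i))
    (hdesc : ∀ i j : Fin n, i ≤ j → lam j ≤ lam i)
    (w : Fin m → (Fin n → ℝ))
    (horth : ∀ i j : Fin m, w i ⬝ᵥ w j = if i = j then (1 : ℝ) else 0)
    (heig : ∀ i : Fin m,
      (L⁻¹ * Q * (L⁻¹)ᵀ) *ᵥ w i = lam (Fin.castLE hmn i) • w i)
    (u : Fin m → (Fin n → ℝ)) (hu : ∀ i, u i = (L⁻¹)ᵀ *ᵥ w i)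
    (M : Matrix (Fin m) (Fin n) ℝ) (hM : ∀ i, M i = u i) :
    (∀ i : Fin m, Q *ᵥ u i = lam (Fin.castLE hmn i) • (S *ᵥ u i)) ∧
    M * S * Mᵀ = 1 ∧
    M.rank = m ∧
    ((M * S * Mᵀ)⁻¹ * (M * Q * Mᵀ)).trace = ∑ i : Fin m, lam (Fin.castLE hmn i) := by
  have hLinv : L * L⁻¹ = 1 := Matrix.mul_nonsing_inv L hL
  have hLinvT : Lᵀ * (L⁻¹)ᵀ = 1 := by
    rw [← Matrix.transpose_mul, Matrix.nonsing_inv_mul L hL, Matrix.transpose_one]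
  have hSu : ∀ i, S *ᵥ u i = L *ᵥ w i := by
    intro i
    rw [hu, hSL, Matrix.mulVec_mulVec, Matrix.mul_assoc, hLinvT, Matrix.mul_one]
  have hgen : ∀ i, Q *ᵥ u i = lam (Fin.castLE hmn i) • (S *ᵥ u i) := by
    intro i
    rw [hSu, ← Matrix.mulVec_smul, ← heig, hu, Matrix.mulVec_mulVec, Matrix.mulVec_mulVec,
      ← Matrix.mul_assoc, ← Matrix.mul_assoc, hLinv, Matrix.one_mul]
  have hMSM : M * S * Mᵀ = 1 := by
    ext i j
    rw [Matrix.mul_mul_transpose_apply_eq_dotProduct, hM, hM, hSu, hu, Matrix.mulVec_transpose,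
      ← Matrix.dotProduct_mulVec, Matrix.mulVec_mulVec, Matrix.nonsing_inv_mul L hL,
      Matrix.one_mulVec, horth, Matrix.one_apply]
  refine ⟨hgen, hMSM, le_antisymm (by simpa using M.rank_le_height) ?_, ?_⟩
  · have h := Matrix.rank_mul_le_left M (S * Mᵀ)
    rwa [← Matrix.mul_assoc, hMSM, Matrix.rank_one, Fintype.card_fin] at h
  · rw [hMSM, inv_one, Matrix.one_mul, Matrix.trace]
    refine Finset.sum_congr rfl fun i _ => ?_
    rw [Matrix.diag_apply, Matrix.mul_mul_transpose_apply_eq_dotProduct, hM, hgen,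
      dotProduct_smul, ← hM, ← Matrix.mul_mul_transpose_apply_eq_dotProduct, hMSM,
      Matrix.one_apply_eq, smul_eq_mul, mul_one]
end

section
/- Let R₁ ∈ ℝ^{p×p} and R₂ ∈ ℝ^{n×n} be symmetric positive definite and H₂ ∈ ℝ^{n×p}, and define J(ω,Φ) = trace((ω R₁⁻¹ + (1−ω) H₂ᵀ Φᵀ (Φ R₂ Φᵀ)⁻¹ Φ H₂)⁻¹) for ω ∈ (0,1] and Φ ∈ ℝ^{m×n} of rank m. Suppose sequences {ω_k}_{k≥0} ⊆ (0,1] and {Φ_k}_{k≥1} of rank-m matrices are generated by alternating minimization, i.e., for each k ≥ 1: J(ω_{k−1}, Φ_k) ≤ J(ω_{k−1}, Φ) for every Φ ∈ ℝ^{m×n} of rank m, and J(ω_k, Φ_k) ≤ J(ω, Φ_k) for every ω ∈ (0,1]. Then the sequence J_k = J(ω_k, Φ_k) satisfies J_{k+1} ≤ J_k for all k, is bounded below by the positive constant trace((R₁⁻¹ + H₂ᵀ R₂⁻¹ H₂)⁻¹), and therefore converges to a finite limit. (Monotone-convergence core of the paper's Theorem 2 on the GEVO-CI algorithm.) -/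
open Matrix

namespace Matrix

variable {p n m : Type*} [Fintype n] [Fintype m] [DecidableEq m]

theorem nonsing_inv_mul_mul_nonsing_inv (S : Matrix m m ℝ) : S⁻¹ * S * S⁻¹ = S⁻¹ := by
  by_cases h : IsUnit S.det
  · rw [nonsing_inv_mul _ h, one_mul]
  · simp [nonsing_inv_apply_not_isUnit _ h]

/-- The information matrix of the compressed measurement `Φ`, written as a congruence. -/
theorem compressed_information_eq (R : Matrix n n ℝ) (Φ : Matrix m n ℝ) :
    (Φᵀ * (Φ * R * Φᵀ)⁻¹ * Φ) * R * (Φᵀ * (Φ * R * Φᵀ)⁻¹ * Φ) =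
      Φᵀ * (Φ * R * Φᵀ)⁻¹ * Φ := by
  have h := nonsing_inv_mul_mul_nonsing_inv (Φ * R * Φᵀ)
  calc _ = Φᵀ * ((Φ * R * Φᵀ)⁻¹ * (Φ * R * Φᵀ) * (Φ * R * Φᵀ)⁻¹) * Φ := by
        simp only [Matrix.mul_assoc]
    _ = _ := by rw [h]

theorem transpose_compressed_information {R : Matrix n n ℝ} (hR : Rᵀ = R) (Φ : Matrix m n ℝ) :
    (Φᵀ * (Φ * R * Φᵀ)⁻¹ * Φ)ᵀ = Φᵀ * (Φ * R * Φᵀ)⁻¹ * Φ := by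
  simp only [transpose_mul, transpose_transpose, transpose_nonsing_inv, hR, Matrix.mul_assoc]

theorem PosSemidef.transpose_mul_mul [Finite p] {A : Matrix n n ℝ} (hA : A.PosSemidef)
    (B : Matrix n p ℝ) : (Bᵀ * A * B).PosSemidef := by
  simpa using hA.conjTranspose_mul_mul_same B

theorem PosDef.transpose_eq {ι : Type*} {R : Matrix ι ι ℝ} (hR : R.PosDef) : Rᵀ = R := by
  simpa using hR.isHermitian.eq

theorem PosDef.posSemidef_compressed_information {R : Matrix n n ℝ} (hR : R.PosDef)
    (Φ : Matrix m n ℝ) : (Φᵀ * (Φ * R * Φᵀ)⁻¹ * Φ).PosSemidef := by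
  have h := hR.posSemidef.transpose_mul_mul (Φᵀ * (Φ * R * Φᵀ)⁻¹ * Φ)
  rwa [transpose_compressed_information hR.transpose_eq, compressed_information_eq] at h

theorem PosDef.posSemidef_inv_sub_compressed_information [DecidableEq n]
    {R : Matrix n n ℝ} (hR : R.PosDef) (Φ : Matrix m n ℝ) : (R⁻¹ - Φᵀ * (Φ * R * Φᵀ)⁻¹ * Φ).PosSemidef := by
  have hT := transpose_compressed_information hR.transpose_eq Φ
  have hP := compressed_information_eq R Φ
  set P := Φᵀ * (Φ * R * Φᵀ)⁻¹ * Φ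
  have hu : IsUnit R.det := (isUnit_iff_isUnit_det _).1 hR.isUnit
  have h := hR.posSemidef.transpose_mul_mul (R⁻¹ - P)
  rw [transpose_sub, hT, transpose_nonsing_inv, hR.transpose_eq] at h
  have e : (R⁻¹ - P) * R * (R⁻¹ - P) = R⁻¹ - P := by
    rw [Matrix.sub_mul, nonsing_inv_mul _ hu, Matrix.mul_sub, Matrix.sub_mul, Matrix.sub_mul,
      hP, Matrix.mul_assoc P, mul_nonsing_inv _ hu]
    simp
  rwa [e] at h

theorem PosDef.posSemidef_inv_sub_inv [DecidableEq n] {M N : Matrix n n ℝ}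
    (hM : M.PosDef) (hN : N.PosDef) (hMN : (N - M).PosSemidef) : (M⁻¹ - N⁻¹).PosSemidef := by
  have hu : IsUnit M.det := (isUnit_iff_isUnit_det _).1 hM.isUnit
  have hv : IsUnit N.det := (isUnit_iff_isUnit_det _).1 hN.isUnit
  have h1 := hM.inv.posSemidef.transpose_mul_mul (N - M)
  have h := (hMN.add h1).transpose_mul_mul N⁻¹
  rw [transpose_sub, transpose_nonsing_inv, hN.transpose_eq, hM.transpose_eq] at h
  have e : N - M + (N - M) * M⁻¹ * (N - M) = N * M⁻¹ * N - N := by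
    rw [Matrix.sub_mul, mul_nonsing_inv _ hu, Matrix.mul_sub, Matrix.sub_mul, Matrix.sub_mul,
      Matrix.mul_assoc N M⁻¹ M, nonsing_inv_mul _ hu]
    simp
  have e' : N⁻¹ * (N * M⁻¹ * N - N) * N⁻¹ = M⁻¹ - N⁻¹ := by
    rw [Matrix.mul_sub, nonsing_inv_mul _ hv, Matrix.sub_mul, Matrix.mul_assoc N,
      ← Matrix.mul_assoc N⁻¹, nonsing_inv_mul _ hv, Matrix.one_mul, Matrix.one_mul,
      Matrix.mul_assoc, mul_nonsing_inv _ hv, Matrix.mul_one]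
  rwa [e, e'] at h

/-- The covariance-intersection loss dominates the loss of the optimal fusion of two
uncorrelated estimates. -/
theorem trace_inv_fusion_le [Fintype p] [DecidableEq p] [DecidableEq n]
    {R₁ : Matrix p p ℝ} (hR₁ : R₁.PosDef) {R₂ : Matrix n n ℝ} (hR₂ : R₂.PosDef) (H : Matrix n p ℝ)
    {ω : ℝ} (hω : ω ∈ Set.Ioc (0 : ℝ) 1) (Φ : Matrix m n ℝ) :
    ((R₁⁻¹ + Hᵀ * R₂⁻¹ * H)⁻¹).trace ≤
      ((ω • R₁⁻¹ + (1 - ω) • (Hᵀ * Φᵀ * (Φ * R₂ * Φᵀ)⁻¹ * Φ * H))⁻¹).trace := by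
  have hω' : 0 ≤ 1 - ω := sub_nonneg.2 hω.2
  have hassoc : Hᵀ * Φᵀ * (Φ * R₂ * Φᵀ)⁻¹ * Φ * H =
      Hᵀ * (Φᵀ * (Φ * R₂ * Φᵀ)⁻¹ * Φ) * H := by simp only [Matrix.mul_assoc]
  rw [hassoc]
  have hP := (hR₂.posSemidef_compressed_information Φ).transpose_mul_mul H
  have hQ := (hR₂.posSemidef_inv_sub_compressed_information Φ).transpose_mul_mul H
  have hR := hR₂.inv.posSemidef.transpose_mul_mul H
  have hM := (hR₁.inv.smul hω.1).add_posSemidef (hP.smul hω')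
  have hN := hR₁.inv.add_posSemidef hR
  have hD := ((hR₁.inv.posSemidef.smul hω').add (hR.smul hω.1.le)).add (hQ.smul hω')
  rw [Matrix.mul_sub, Matrix.sub_mul] at hD
  have hMN : R₁⁻¹ + Hᵀ * R₂⁻¹ * H -
      (ω • R₁⁻¹ + (1 - ω) • (Hᵀ * (Φᵀ * (Φ * R₂ * Φᵀ)⁻¹ * Φ) * H)) =
      (1 - ω) • R₁⁻¹ + ω • (Hᵀ * R₂⁻¹ * H) + (1 - ω) •
        (Hᵀ * R₂⁻¹ * H - Hᵀ * (Φᵀ * (Φ * R₂ * Φᵀ)⁻¹ * Φ) * H) := by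
    simp only [smul_sub, sub_smul, one_smul]
    abel
  have h := (hM.posSemidef_inv_sub_inv hN (hMN ▸ hD)).trace_nonneg
  rw [trace_sub] at h
  linarith

end Matrix

/-- Monotone-convergence core of the paper's Theorem 2 (GEVO-CI): alternating minimization of
the CI loss produces a nonincreasing sequence of loss values, bounded below by the positive
constant `trace((R₁⁻¹ + H₂ᵀ R₂⁻¹ H₂)⁻¹)`, hence convergent. Here `Φ k` for `k ≥ 1` are the
iterates (indexed via `Φ (k+1)`) and `ω k` the weights. -/
theorem stmt_8 {p n m : ℕ} (hp : 0 < p)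
    (R₁ : Matrix (Fin p) (Fin p) ℝ) (hR₁ : R₁.PosDef)
    (R₂ : Matrix (Fin n) (Fin n) ℝ) (hR₂ : R₂.PosDef)
    (H₂ : Matrix (Fin n) (Fin p) ℝ)
    (J : ℝ → Matrix (Fin m) (Fin n) ℝ → ℝ)
    (hJ : ∀ ω Φ, J ω Φ =
      ((ω • R₁⁻¹ + (1 - ω) • (H₂ᵀ * Φᵀ * (Φ * R₂ * Φᵀ)⁻¹ * Φ * H₂))⁻¹).trace)
    (ω : ℕ → ℝ) (Φ : ℕ → Matrix (Fin m) (Fin n) ℝ)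
    (hω : ∀ k, ω k ∈ Set.Ioc (0 : ℝ) 1)
    (hΦrank : ∀ k, (Φ (k + 1)).rank = m)
    (hstep1 : ∀ k, ∀ Ψ : Matrix (Fin m) (Fin n) ℝ, Ψ.rank = m →
      J (ω k) (Φ (k + 1)) ≤ J (ω k) Ψ)
    (hstep2 : ∀ k, ∀ v ∈ Set.Ioc (0 : ℝ) 1, J (ω (k + 1)) (Φ (k + 1)) ≤ J v (Φ (k + 1))) :
    (∀ k, J (ω (k + 2)) (Φ (k + 2)) ≤ J (ω (k + 1)) (Φ (k + 1))) ∧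
    0 < ((R₁⁻¹ + H₂ᵀ * R₂⁻¹ * H₂)⁻¹).trace ∧
    (∀ k, ((R₁⁻¹ + H₂ᵀ * R₂⁻¹ * H₂)⁻¹).trace ≤ J (ω (k + 1)) (Φ (k + 1))) ∧
    (∃ Jlim : ℝ, Filter.Tendsto (fun k => J (ω (k + 1)) (Φ (k + 1)))
      Filter.atTop (nhds Jlim)) := by
  have hpos : 0 < ((R₁⁻¹ + H₂ᵀ * R₂⁻¹ * H₂)⁻¹).trace := by
    have : Nonempty (Fin p) := ⟨⟨0, hp⟩⟩
    exact (hR₁.inv.add_posSemidef (hR₂.inv.posSemidef.transpose_mul_mul H₂)).inv.trace_pos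
  have hmono : ∀ k, J (ω (k + 2)) (Φ (k + 2)) ≤ J (ω (k + 1)) (Φ (k + 1)) := fun k =>
    (hstep2 (k + 1) _ (hω (k + 1))).trans (hstep1 (k + 1) _ (hΦrank k))
  have hbound : ∀ k, ((R₁⁻¹ + H₂ᵀ * R₂⁻¹ * H₂)⁻¹).trace ≤ J (ω (k + 1)) (Φ (k + 1)) := by
    intro k
    rw [hJ]
    exact trace_inv_fusion_le hR₁ hR₂ H₂ (hω (k + 1)) (Φ (k + 1))
  exact ⟨hmono, hpos, hbound, _, tendsto_atTop_ciInf (antitone_nat_of_succ_le hmono)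
    ⟨_, Set.forall_mem_range.2 hbound⟩⟩
end

section
/- Let V ∈ ℝ^{n×n} be orthogonal with columns v₁, …, v_n, and let R₁ = V Σ Vᵀ and R₂ = V Π Vᵀ with Σ = diag(μ₁, …, μ_n), Π = diag(π₁, …, π_n), μ₁ ≥ … ≥ μ_n > 0 and π₁ ≥ … ≥ π_n > 0. Assume additionally that the values λᵢ = μᵢ²/(μᵢ + πᵢ) are in descending order, λ₁ ≥ … ≥ λ_n (as the paper derives from the orderings of μ and π). For M ∈ ℝ^{m×n} define the Kalman-fuser fused covariance (with H₂ = I and zero cross-covariance) P(M) = R₁ − R₁ Mᵀ (M (R₁ + R₂) Mᵀ)⁻¹ M R₁. Then the PCO matrix M_PCO = col(v_{n−m+1}ᵀ, …, v_nᵀ), whose rows are the eigenvectors of R₂ corresponding to its m smallest eigenvalues, solves maximize trace(P(M)) subject to M Mᵀ = I_m. That is, when R₁ and R₂ share eigenvectors with correspondingly ordered eigenvalues, principal-component-based dimension reduction yields the worst possible fused mean squared error among all orthonormal-row reductions. (The paper's Theorem 3.) -/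
open Matrix

/-- A sum of `f` with weights in `[0, 1]` of total mass `m` is at least the sum of `f` over
`m` indices on which `f` lies below a threshold that bounds `f` from below elsewhere. -/
theorem sum_comp_le_sum_weighted {n m : ℕ} (e : Fin m → Fin n) (he : Function.Injective e)
    (f w : Fin n → ℝ) (c : ℝ) (hle : ∀ i, f (e i) ≤ c) (hge : ∀ j, j ∉ Set.range e → c ≤ f j)
    (hw0 : ∀ j, 0 ≤ w j) (hw1 : ∀ j, w j ≤ 1) (hw : ∑ j, w j = m) :
    ∑ i, f (e i) ≤ ∑ j, w j * f j := by
  classical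
  have key : ∑ i, (f (e i) - c) ≤ ∑ j, w j * (f j - c) := by
    rw [← Finset.sum_image (s := Finset.univ) (g := e) (f := fun j => f j - c) he.injOn,
      ← Finset.sum_filter_add_sum_filter_not Finset.univ (· ∈ Set.range e)
        (fun j => w j * (f j - c))]
    have hrange : Finset.univ.image e = Finset.univ.filter (· ∈ Set.range e) := by
      ext j
      simp
    rw [hrange]
    refine le_add_of_le_of_nonneg (Finset.sum_le_sum fun j hj => ?_)
      (Finset.sum_nonneg fun j hj => ?_)
    · obtain ⟨i, rfl⟩ := (Finset.mem_filter.1 hj).2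
      nlinarith [hle i, hw1 (e i)]
    · exact mul_nonneg (hw0 j) (sub_nonneg.2 (hge j (Finset.mem_filter.1 hj).2))
  simp only [mul_sub, Finset.sum_sub_distrib, ← Finset.sum_mul, hw] at key
  simpa using key

/-- If `K` is symmetric with `K D K = K` for a positive diagonal matrix `D`, then the diagonal
entries of `D K` lie in `[0, 1]`. -/
theorem diag_mem_Icc_of_mul_diagonal_mul_self {ι : Type*} [Fintype ι] [DecidableEq ι]
    (K : Matrix ι ι ℝ) (d : ι → ℝ) (hd : ∀ i, 0 < d i) (hK : Kᵀ = K)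
    (hKDK : K * diagonal d * K = K) (i : ι) : d i * K i i ∈ Set.Icc 0 1 := by
  have hsum : K i i = ∑ j, d j * K i j ^ 2 := by
    conv_lhs => rw [← hKDK]
    rw [mul_apply]
    refine Finset.sum_congr rfl fun j _ => ?_
    have hji : K j i = K i j := congrFun (congrFun hK i) j
    rw [mul_diagonal, hji]
    ring
  have hterm : ∀ j, 0 ≤ d j * K i j ^ 2 := fun j => mul_nonneg (hd j).le (sq_nonneg _)
  have hnn : 0 ≤ K i i := hsum ▸ Finset.sum_nonneg fun j _ => hterm j
  have hsq : d i * K i i ^ 2 ≤ K i i := by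
    conv_rhs => rw [hsum]
    exact Finset.single_le_sum (f := fun j => d j * K i j ^ 2) (fun j _ => hterm j)
      (Finset.mem_univ i)
  refine ⟨mul_nonneg (hd i).le hnn, ?_⟩
  rcases hnn.eq_or_lt with h | h
  · simp [← h]
  · have : d i * K i i * K i i ≤ 1 * K i i := by nlinarith
    exact le_of_mul_le_mul_right this h

theorem isUnit_mul_diagonal_mul_transpose {ι κ : Type*} [Fintype ι] [DecidableEq ι]
    [Fintype κ] [DecidableEq κ] (N : Matrix κ ι ℝ) (hN : N * Nᵀ = 1) (d : ι → ℝ)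
    (hd : ∀ i, 0 < d i) : IsUnit (N * diagonal d * Nᵀ).det := by
  have hD : (diagonal d).PosDef := PosDef.diagonal hd
  have hinj : Function.Injective N.vecMul := fun x y hxy => by
    simpa [vecMul_vecMul, hN] using congrArg (· ᵥ* Nᵀ) hxy
  have := hD.mul_mul_conjTranspose_same (B := N) hinj
  rw [conjTranspose_eq_transpose_of_trivial] at this
  exact (isUnit_iff_isUnit_det _).1 this.isUnit

/-- The sum of `a ^ 2 / d` over `m` indices carrying its smallest values bounds from below the
trace of `diag(a) Nᵀ (N diag(d) Nᵀ)⁻¹ N diag(a)` for `N` with orthonormal rows. -/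
theorem sum_comp_le_trace {n m : ℕ} (e : Fin m → Fin n) (he : Function.Injective e)
    (a d : Fin n → ℝ) (hd : ∀ i, 0 < d i) (c : ℝ) (hle : ∀ i, a (e i) ^ 2 / d (e i) ≤ c)
    (hge : ∀ j, j ∉ Set.range e → c ≤ a j ^ 2 / d j)
    (N : Matrix (Fin m) (Fin n) ℝ) (hN : N * Nᵀ = 1) :
    ∑ i, a (e i) ^ 2 / d (e i) ≤
      (diagonal a * (Nᵀ * (N * diagonal d * Nᵀ)⁻¹ * N) * diagonal a).trace := by
  have hu := isUnit_mul_diagonal_mul_transpose N hN d hd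
  set G := N * diagonal d * Nᵀ with hG
  have hGt : Gᵀ = G := by simp [hG, Matrix.mul_assoc]
  set K := Nᵀ * G⁻¹ * N with hK
  have hKt : Kᵀ = K := by simp [hK, transpose_nonsing_inv, hGt, Matrix.mul_assoc]
  have hKDK : K * diagonal d * K = K := by
    calc K * diagonal d * K = Nᵀ * (G⁻¹ * (N * diagonal d * Nᵀ) * G⁻¹) * N := by
          simp only [hK, Matrix.mul_assoc]
      _ = K := by rw [← hG, nonsing_inv_mul _ hu, Matrix.one_mul]
  have hmem := diag_mem_Icc_of_mul_diagonal_mul_self K d hd hKt hKDK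
  have htr : ∑ j, d j * K j j = m := by
    calc ∑ j, d j * K j j = (diagonal d * K).trace := by simp [trace, diagonal_mul]
      _ = (G⁻¹ * (N * diagonal d * Nᵀ)).trace := by
          rw [hK, ← Matrix.mul_assoc, trace_mul_comm, ← Matrix.mul_assoc, ← Matrix.mul_assoc,
            trace_mul_comm]
      _ = m := by rw [← hG, nonsing_inv_mul _ hu]; simp
  refine (sum_comp_le_sum_weighted e he (fun j => a j ^ 2 / d j) (fun j => d j * K j j) c hle hge
    (fun j => (hmem j).1) (fun j => (hmem j).2) htr).trans_eq ?_
  rw [trace]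
  refine Finset.sum_congr rfl fun j _ => ?_
  have := (hd j).ne'
  simp only [diag_apply, mul_diagonal, diagonal_mul]
  field_simp

theorem trace_submatrix_one_eq_sum {ι κ : Type*} [Fintype ι] [DecidableEq ι]
    [Fintype κ] [DecidableEq κ] (e : κ → ι) (he : Function.Injective e)
    (a d : ι → ℝ) (hd : ∀ i, 0 < d i) (N : Matrix κ ι ℝ)
    (hN : N = (1 : Matrix ι ι ℝ).submatrix e id) :
    (diagonal a * (Nᵀ * (N * diagonal d * Nᵀ)⁻¹ * N) * diagonal a).trace =
      ∑ i, a (e i) ^ 2 / d (e i) := by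
  have hconj : ∀ b : ι → ℝ, N * diagonal b * Nᵀ = diagonal (b ∘ e) := by
    intro b
    ext i j
    simp [hN, mul_apply, diagonal_apply, one_apply, he.eq_iff]
    split_ifs with h <;> simp [h]
  have hinv : (diagonal (d ∘ e))⁻¹ = diagonal fun i => (d (e i))⁻¹ := by
    refine inv_eq_left_inv ?_
    rw [diagonal_mul_diagonal, ← diagonal_one]
    exact congrArg diagonal (funext fun i => inv_mul_cancel₀ (hd (e i)).ne')
  calc _ = ((N * diagonal d * Nᵀ)⁻¹ * (N * (diagonal a * diagonal a) * Nᵀ)).trace := by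
        rw [trace_mul_comm, ← Matrix.mul_assoc, Matrix.mul_assoc Nᵀ, ← Matrix.mul_assoc _ Nᵀ,
          trace_mul_comm]
        simp only [Matrix.mul_assoc]
    _ = _ := by
        rw [diagonal_mul_diagonal, hconj, hconj, hinv, diagonal_mul_diagonal, trace_diagonal]
        refine Finset.sum_congr rfl fun i _ => ?_
        simp only [Function.comp_apply]
        ring

/-- Orthogonal change of basis in the trace of the fused covariance. -/
theorem trace_fused_eq {ι κ : Type*} [Fintype ι] [DecidableEq ι] [Fintype κ] [DecidableEq κ]
    (V : Matrix ι ι ℝ) (hV : Vᵀ * V = 1) (a b : ι → ℝ) (M : Matrix κ ι ℝ) :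
    (V * diagonal a * Vᵀ - V * diagonal a * Vᵀ * Mᵀ *
      (M * (V * diagonal a * Vᵀ + V * diagonal b * Vᵀ) * Mᵀ)⁻¹ * M *
        (V * diagonal a * Vᵀ)).trace =
      (V * diagonal a * Vᵀ).trace -
        (diagonal a * ((M * V)ᵀ * (M * V * diagonal (fun i => a i + b i) * (M * V)ᵀ)⁻¹ * (M * V)) *
          diagonal a).trace := by
  have hS : M * (V * diagonal a * Vᵀ + V * diagonal b * Vᵀ) * Mᵀ =
      M * V * diagonal (fun i => a i + b i) * (M * V)ᵀ := by
    rw [← Matrix.add_mul, ← Matrix.mul_add, diagonal_add, transpose_mul]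
    simp only [Matrix.mul_assoc]
  rw [trace_sub, hS]
  congr 1
  set G := (M * V * diagonal (fun i => a i + b i) * (M * V)ᵀ)⁻¹
  calc _ = (V * (diagonal a * ((M * V)ᵀ * G * (M * V)) * diagonal a * Vᵀ)).trace := by
        simp only [transpose_mul, Matrix.mul_assoc]
    _ = _ := by rw [trace_mul_comm, Matrix.mul_assoc, hV, Matrix.mul_one]

/-- Paper's Theorem 3: when `R₁ = V Σ Vᵀ` and `R₂ = V Π Vᵀ` share eigenvectors with
correspondingly (descending) ordered eigenvalues, the PCO matrix — whose rows are the
eigenvectors of `R₂` associated with its `m` smallest eigenvalues — maximizes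
`trace(P(M))` over all `M` with orthonormal rows, where
`P(M) = R₁ − R₁ Mᵀ (M (R₁+R₂) Mᵀ)⁻¹ M R₁` is the Kalman-fuser fused covariance. -/
theorem stmt_9 {n m : ℕ} (hmn : m ≤ n)
    (V : Matrix (Fin n) (Fin n) ℝ) (hV : Vᵀ * V = 1) (hV' : V * Vᵀ = 1)
    (μ π : Fin n → ℝ)
    (hμpos : ∀ i, 0 < μ i) (hπpos : ∀ i, 0 < π i)
    (hμdesc : ∀ i j : Fin n, i ≤ j → μ j ≤ μ i)
    (hπdesc : ∀ i j : Fin n, i ≤ j → π j ≤ π i)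
    (hlamdesc : ∀ i j : Fin n, i ≤ j → μ j ^ 2 / (μ j + π j) ≤ μ i ^ 2 / (μ i + π i))
    (R₁ R₂ : Matrix (Fin n) (Fin n) ℝ)
    (hR₁ : R₁ = V * Matrix.diagonal μ * Vᵀ)
    (hR₂ : R₂ = V * Matrix.diagonal π * Vᵀ)
    (Mpco : Matrix (Fin m) (Fin n) ℝ)
    (hMpco : ∀ (i : Fin m) (j : Fin n),
      Mpco i j = V j ⟨n - m + i, by have := i.isLt; omega⟩) :
    Mpco * Mpcoᵀ = 1 ∧
    ∀ M : Matrix (Fin m) (Fin n) ℝ, M * Mᵀ = 1 →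
      (R₁ - R₁ * Mᵀ * (M * (R₁ + R₂) * Mᵀ)⁻¹ * M * R₁).trace ≤
        (R₁ - R₁ * Mpcoᵀ * (Mpco * (R₁ + R₂) * Mpcoᵀ)⁻¹ * Mpco * R₁).trace := by
  let e : Fin m → Fin n := fun i => ⟨n - m + i, by have := i.isLt; omega⟩
  have he : Function.Injective e := fun i j hij => by
    have := congrArg Fin.val hij
    simp only [e] at this
    exact Fin.ext (by omega)
  have hMe : Mpco = Vᵀ.submatrix e id := Matrix.ext hMpco
  have hNe : Mpco * V = (1 : Matrix (Fin n) (Fin n) ℝ).submatrix e id := by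
    rw [← hV, hMe]
    rfl
  have hd : ∀ i, 0 < μ i + π i := fun i => add_pos (hμpos i) (hπpos i)
  refine ⟨?_, fun M hM => ?_⟩
  · ext i j
    calc (Mpco * Mpcoᵀ) i j = (Vᵀ * V) (e i) (e j) := by rw [hMe]; rfl
      _ = (1 : Matrix (Fin m) (Fin m) ℝ) i j := by simp [hV, one_apply, he.eq_iff]
  · have hN : M * V * (M * V)ᵀ = 1 := by
      rw [transpose_mul, Matrix.mul_assoc, ← Matrix.mul_assoc V, hV', Matrix.one_mul, hM]
    obtain ⟨c, hle, hge⟩ : ∃ c : ℝ, (∀ i, μ (e i) ^ 2 / (μ (e i) + π (e i)) ≤ c) ∧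
        ∀ j, j ∉ Set.range e → c ≤ μ j ^ 2 / (μ j + π j) := by
      rcases Nat.eq_zero_or_pos m with rfl | hm
      · exact ⟨0, fun i => i.elim0, fun j _ => div_nonneg (sq_nonneg _) (hd j).le⟩
      · refine ⟨_, fun i => hlamdesc (e ⟨0, hm⟩) (e i) ?_, fun j hj => hlamdesc j _ ?_⟩
        · simp [e, Fin.le_def]
        · by_contra h
          simp only [e, Fin.le_def] at h
          exact hj ⟨⟨j - (n - m), by omega⟩, Fin.ext (by simp only [e]; omega)⟩
    rw [hR₁, hR₂, trace_fused_eq V hV, trace_fused_eq V hV]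
    refine sub_le_sub_left ?_ _
    rw [trace_submatrix_one_eq_sum e he μ _ hd _ hNe]
    exact sum_comp_le_trace e he μ _ hd c hle hge _ hN
end

section
/- Let R₁ ∈ ℝ^{p×p} be symmetric positive definite, Δ ∈ ℝ^{p×n}, and S ∈ ℝ^{n×n} symmetric positive definite with S = L Lᵀ for invertible L. Let Q = Δᵀ Δ and let λ₁ ≥ … ≥ λ_n be the eigenvalues of L⁻¹ Q L⁻ᵀ. For M ∈ ℝ^{m×n} of rank m define the fused covariance P(M) = R₁ − Δ Mᵀ (M S Mᵀ)⁻¹ M Δᵀ. Then the minimal value of trace(P(M)) over all M ∈ ℝ^{m×n} with rank(M) = m equals ℓ_m = trace(R₁) − (λ₁ + ⋯ + λ_m); moreover ℓ_m is nonincreasing in m, with ℓ_{m−1} − ℓ_m = λ_m ≥ 0. (The fusion-gain identity (24) underlying the paper's adaptive choice of the reduced dimension m.) -/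
open Matrix

namespace FusionGain

lemma sum_mul_le_sum_filter_lt {n m : ℕ} (hmn : m ≤ n) {w lam : Fin n → ℝ}
    (h0 : ∀ i, 0 ≤ w i) (h1 : ∀ i, w i ≤ 1) (hw : ∑ i, w i = m)
    (hlam : ∀ i, 0 ≤ lam i) (hdesc : ∀ i j : Fin n, i ≤ j → lam j ≤ lam i) :
    ∑ i, w i * lam i ≤ ∑ i ∈ Finset.univ.filter (fun i : Fin n => (i : ℕ) < m), lam i := by
  obtain ⟨c, hc1, hc2⟩ : ∃ c, (∀ i : Fin n, (i : ℕ) < m → c ≤ lam i) ∧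
      ∀ i : Fin n, m ≤ (i : ℕ) → lam i ≤ c := by
    rcases hmn.lt_or_eq with h | h
    · exact ⟨lam ⟨m, h⟩, fun i hi => hdesc _ _ (Fin.mk_le_mk.2 hi.le),
        fun i hi => hdesc _ _ (Fin.mk_le_mk.2 hi)⟩
    · exact ⟨0, fun i _ => hlam i, fun i hi => absurd i.2 (by omega)⟩
  have hcard : ∑ i : Fin n, (if (i : ℕ) < m then (1 : ℝ) else 0) = m := by
    rw [Finset.sum_boole, Fin.card_filter_val_lt, min_eq_right hmn]
  have key : ∑ i, (w i * lam i - if (i : ℕ) < m then lam i else 0) ≤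
      ∑ i, c * (w i - if (i : ℕ) < m then (1 : ℝ) else 0) := by
    refine Finset.sum_le_sum fun i _ => ?_
    split_ifs with h
    · nlinarith [hc1 i h, h1 i]
    · nlinarith [hc2 i (not_lt.1 h), h0 i]
  rw [← Finset.mul_sum, Finset.sum_sub_distrib, Finset.sum_sub_distrib, hw, hcard] at key
  rw [Finset.sum_filter]
  linarith

lemma isUnit_det_mul_transpose {m n : ℕ} {N : Matrix (Fin m) (Fin n) ℝ} (hN : N.rank = m) :
    IsUnit (N * Nᵀ).det := by
  rw [← isUnit_iff_isUnit_det, ← linearIndependent_rows_iff_isUnit,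
    linearIndependent_iff_card_eq_finrank_span, Set.finrank, ← rank_eq_finrank_span_row,
    rank_self_mul_transpose, hN, Fintype.card_fin]

/-- The orthogonal projection onto the row space of a matrix of full row rank. -/
noncomputable def rowProj {m n : ℕ} (N : Matrix (Fin m) (Fin n) ℝ) : Matrix (Fin n) (Fin n) ℝ :=
  Nᵀ * (N * Nᵀ)⁻¹ * N

lemma rowProj_transpose {m n : ℕ} (N : Matrix (Fin m) (Fin n) ℝ) : (rowProj N)ᵀ = rowProj N := by
  simp [rowProj, transpose_nonsing_inv, Matrix.mul_assoc]

lemma rowProj_mul_self {m n : ℕ} {N : Matrix (Fin m) (Fin n) ℝ} (hN : N.rank = m) :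
    rowProj N * rowProj N = rowProj N := by
  have h := nonsing_inv_mul _ (isUnit_det_mul_transpose hN)
  calc rowProj N * rowProj N = Nᵀ * ((N * Nᵀ)⁻¹ * (N * Nᵀ)) * (N * Nᵀ)⁻¹ * N := by
        simp only [rowProj, Matrix.mul_assoc]
    _ = rowProj N := by rw [h, Matrix.mul_one, rowProj]

lemma rowProj_trace {m n : ℕ} {N : Matrix (Fin m) (Fin n) ℝ} (hN : N.rank = m) :
    (rowProj N).trace = m := by
  rw [rowProj, Matrix.mul_assoc, trace_mul_comm, Matrix.mul_assoc,
    nonsing_inv_mul _ (isUnit_det_mul_transpose hN), trace_one, Fintype.card_fin]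

lemma rowProj_diag_mem {m n : ℕ} {N : Matrix (Fin m) (Fin n) ℝ} (hN : N.rank = m) (i : Fin n) :
    0 ≤ rowProj N i i ∧ rowProj N i i ≤ 1 := by
  have h : rowProj N i i = ∑ j, rowProj N i j ^ 2 := by
    conv_lhs => rw [← rowProj_mul_self hN, mul_apply]
    refine Finset.sum_congr rfl fun j _ => ?_
    rw [sq, ← transpose_apply (rowProj N), rowProj_transpose]
  have h2 : rowProj N i i ^ 2 ≤ rowProj N i i := by
    conv_rhs => rw [h]
    exact Finset.single_le_sum (f := fun j => rowProj N i j ^ 2)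
      (fun j _ => sq_nonneg _) (Finset.mem_univ i)
  constructor <;> nlinarith [sq_nonneg (rowProj N i i)]

lemma trace_fused_eq {p n m : ℕ} (Δ : Matrix (Fin p) (Fin n) ℝ) (L V : Matrix (Fin n) (Fin n) ℝ)
    (hL : IsUnit L.det) (hV : V * Vᵀ = 1) (lam : Fin n → ℝ)
    (hA : L⁻¹ * (Δᵀ * Δ) * (L⁻¹)ᵀ = V * diagonal lam * Vᵀ) (M : Matrix (Fin m) (Fin n) ℝ) :
    (Δ * Mᵀ * (M * (L * Lᵀ) * Mᵀ)⁻¹ * M * Δᵀ).trace =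
      ∑ i, rowProj (M * L * V) i i * lam i := by
  have hLL := mul_nonsing_inv _ hL
  have hQ : Δᵀ * Δ = L * V * diagonal lam * (L * V)ᵀ := by
    calc Δᵀ * Δ = (L * L⁻¹) * (Δᵀ * Δ) * (L * L⁻¹)ᵀ := by rw [hLL]; simp
      _ = L * (L⁻¹ * (Δᵀ * Δ) * (L⁻¹)ᵀ) * Lᵀ := by
        simp only [transpose_mul, Matrix.mul_assoc]
      _ = _ := by rw [hA]; simp only [transpose_mul, Matrix.mul_assoc]
  have hN : M * (L * Lᵀ) * Mᵀ = (M * L * V) * (M * L * V)ᵀ := by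
    calc M * (L * Lᵀ) * Mᵀ = M * L * (1 : Matrix (Fin n) (Fin n) ℝ) * Lᵀ * Mᵀ := by
          simp only [Matrix.mul_one, Matrix.mul_assoc]
      _ = _ := by rw [← hV]; simp only [transpose_mul, Matrix.mul_assoc]
  calc (Δ * Mᵀ * (M * (L * Lᵀ) * Mᵀ)⁻¹ * M * Δᵀ).trace
      = (Mᵀ * (M * (L * Lᵀ) * Mᵀ)⁻¹ * M * (Δᵀ * Δ)).trace := by
        rw [Matrix.mul_assoc Δ, Matrix.mul_assoc Δ, Matrix.mul_assoc Δ, trace_mul_comm]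
        simp only [Matrix.mul_assoc]
    _ = (rowProj (M * L * V) * diagonal lam).trace := by
        rw [hQ, ← Matrix.mul_assoc, trace_mul_comm, hN, rowProj]
        simp only [transpose_mul, Matrix.mul_assoc]
    _ = _ := by simp [trace, mul_diagonal]

end FusionGain

open FusionGain in
/-- Fusion-gain identity (24): with `Q = Δᵀ Δ`, `S = L Lᵀ ≻ 0`, and eigenvalues `lam` of
`L⁻¹ Q L⁻ᵀ` in descending order, the minimal value of
`trace(P(M)) = trace(R₁ − Δ Mᵀ (M S Mᵀ)⁻¹ M Δᵀ)` over rank-`m` matrices `M` equals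
`ℓ_m = trace(R₁) − (λ₁ + ⋯ + λ_m)`, and `ℓ` is nonincreasing with
`ℓ_{k} − ℓ_{k+1} = λ_{k+1} ≥ 0`. -/
theorem stmt_15 {p n m : ℕ} (hmn : m ≤ n)
    (R₁ : Matrix (Fin p) (Fin p) ℝ) (hR₁ : R₁.PosDef)
    (Δ : Matrix (Fin p) (Fin n) ℝ)
    (S L : Matrix (Fin n) (Fin n) ℝ)
    (hS : S.PosDef) (hL : IsUnit L.det) (hSL : S = L * Lᵀ)
    (hA : (L⁻¹ * (Δᵀ * Δ) * (L⁻¹)ᵀ).IsHermitian)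
    (lam : Fin n → ℝ) (σ : Equiv.Perm (Fin n))
    (hlam : ∀ i, lam i = hA.eigenvalues (σ i))
    (hdesc : ∀ i j : Fin n, i ≤ j → lam j ≤ lam i)
    (ℓ : ℕ → ℝ)
    (hℓ : ∀ k, ℓ k = R₁.trace -
      ∑ i ∈ Finset.univ.filter (fun i : Fin n => (i : ℕ) < k), lam i) :
    IsLeast {t : ℝ | ∃ M : Matrix (Fin m) (Fin n) ℝ, M.rank = m ∧
        t = (R₁ - Δ * Mᵀ * (M * S * Mᵀ)⁻¹ * M * Δᵀ).trace} (ℓ m) ∧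
    ∀ i : Fin n, ℓ (i : ℕ) - ℓ ((i : ℕ) + 1) = lam i ∧ 0 ≤ lam i := by
  subst hSL
  have hnn : ∀ i, 0 ≤ lam i := by
    have hpsd : (L⁻¹ * (Δᵀ * Δ) * (L⁻¹)ᵀ).PosSemidef := by
      simpa using (posSemidef_conjTranspose_mul_self Δ).mul_mul_conjTranspose_same L⁻¹
    intro i
    rw [hlam]
    exact hpsd.eigenvalues_nonneg _
  let U : Matrix (Fin n) (Fin n) ℝ := hA.eigenvectorUnitary
  let V : Matrix (Fin n) (Fin n) ℝ := U.submatrix id σ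
  have hU : U * Uᵀ = 1 := by
    simpa [star_eq_conjTranspose] using Unitary.coe_mul_star_self hA.eigenvectorUnitary
  have hV : V * Vᵀ = 1 := by
    rw [transpose_submatrix, submatrix_mul_equiv, hU, submatrix_id_id]
  have hV' : Vᵀ * V = 1 := mul_eq_one_comm.1 hV
  have hAV : L⁻¹ * (Δᵀ * Δ) * (L⁻¹)ᵀ = V * diagonal lam * Vᵀ := by
    have hD : diagonal lam = (diagonal hA.eigenvalues).submatrix σ σ := by
      rw [submatrix_diagonal_equiv]
      congr 1
      exact funext hlam
    rw [hD, transpose_submatrix, submatrix_mul_equiv, submatrix_mul_equiv, submatrix_id_id]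
    have h := hA.spectral_theorem
    rw [Unitary.conjStarAlgAut_apply] at h
    simpa [star_eq_conjTranspose] using h
  have hVdet : IsUnit V.det := (isUnit_iff_isUnit_det V).1 (IsUnit.of_mul_eq_one _ hV)
  have hrank (M : Matrix (Fin m) (Fin n) ℝ) : (M * L * V).rank = M.rank := by
    rw [rank_mul_eq_left_of_isUnit_det _ _ hVdet, rank_mul_eq_left_of_isUnit_det _ _ hL]
  refine ⟨⟨?_, ?_⟩, ?_⟩
  · let N : Matrix (Fin m) (Fin n) ℝ := (1 : Matrix (Fin n) (Fin n) ℝ).submatrix (Fin.castLE hmn) id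
    have hNN : N * Nᵀ = 1 := by
      rw [transpose_submatrix, ← submatrix_mul _ _ _ _ _ Function.bijective_id, transpose_one,
        Matrix.mul_one, submatrix_one _ (Fin.castLE_injective hmn)]
    have hM : N * Vᵀ * L⁻¹ * L * V = N := by
      rw [nonsing_inv_mul_cancel_right _ _ hL, Matrix.mul_assoc, hV', Matrix.mul_one]
    refine ⟨N * Vᵀ * L⁻¹, ?_, ?_⟩
    · rw [← hrank, hM, ← rank_self_mul_transpose, hNN, rank_one, Fintype.card_fin]
    · rw [trace_sub, trace_fused_eq Δ L V hL hV lam hAV, hM, hℓ, rowProj, hNN, inv_one,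
        Matrix.mul_one, Finset.sum_filter]
      congr 1
      refine Finset.sum_congr rfl fun i _ => ?_
      have : (Nᵀ * N) i i = if (i : ℕ) < m then 1 else 0 := by
        simp only [N, mul_apply, transpose_apply, submatrix_apply, id, one_apply, mul_ite, mul_one,
          mul_zero]
        split_ifs with h
        · rw [Finset.sum_eq_single ⟨i, h⟩] <;> simp +contextual [Fin.ext_iff]
        · refine Finset.sum_eq_zero fun k _ => ?_
          have : Fin.castLE hmn k ≠ i := fun hk => h (hk ▸ k.2)
          simp [this]
      rw [this]
      split_ifs <;> simp
  · rintro t ⟨M, hM, rfl⟩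
    rw [trace_sub, trace_fused_eq Δ L V hL hV lam hAV, hℓ]
    have hN := (hrank M).trans hM
    exact sub_le_sub_left (sum_mul_le_sum_filter_lt hmn (fun i => (rowProj_diag_mem hN i).1)
      (fun i => (rowProj_diag_mem hN i).2) (rowProj_trace hN) hnn hdesc) _
  · intro i
    refine ⟨?_, hnn i⟩
    have h : Finset.univ.filter (fun j : Fin n => (j : ℕ) < i + 1) =
        insert i (Finset.univ.filter (fun j : Fin n => (j : ℕ) < i)) := by
      ext j
      simp [Fin.ext_iff]
      omega
    rw [hℓ, hℓ, h, Finset.sum_insert (by simp)]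
    ring
end
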